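/- arXiv:1111.7148 — 4 statements merged into one kernel-verified Lean document; each statement's English description precedes it below -/
import Mathlib

section
/- Every second-countable Stone space is ultrametrizable: if X is a topological space that is compact, Hausdorff, totally disconnected, and second-countable, then there exists a metric space structure d on X inducing the given topology such that d satisfies the strong triangle inequality d(x,z) ≤ max(d(x,y), d(y,z)). -/
/-- A second-countable Stone space embeds into the Cantor space, by evaluating the members of an
enumeration of its clopen subsets. -/
theorem exists_isEmbedding_nat_bool (X : Type*) [TopologicalSpace X] [CompactSpace X] [T2Space X]
    [TotallyDisconnectedSpace X] [SecondCountableTopology X] :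
    ∃ f : X → ℕ → Bool, Topology.IsEmbedding f := by
  have : Countable (TopologicalSpace.Clopens X) :=
    TopologicalSpace.Clopens.countable_iff_secondCountable.mpr inferInstance
  obtain ⟨b, hb⟩ := exists_surjective_nat (TopologicalSpace.Clopens X)
  refine ⟨fun x n => (b n : Set X).boolIndicator x, ?_⟩
  refine (Continuous.isClosedEmbedding ?_ fun x y hxy => ?_).isEmbedding
  · exact continuous_pi fun n => (continuous_boolIndicator_iff_isClopen _).mpr (b n).isClopen
  · by_contra hne
    obtain ⟨U, hU, hx, hy⟩ := exists_isClopen_of_totally_separated hne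
    obtain ⟨n, hn⟩ := hb ⟨U, hU⟩
    have hn' : (b n : Set X) = U := by rw [hn]; rfl
    have hxn : U.boolIndicator x = U.boolIndicator y := hn' ▸ congrFun hxy n
    rw [(Set.mem_iff_boolIndicator U x).mp hx, (Set.notMem_iff_boolIndicator U y).mp hy] at hxn
    exact Bool.noConfusion hxn

/-- Every second-countable Stone space is ultrametrizable. -/
theorem second_countable_stone_ultrametrizable (X : Type*) [t : TopologicalSpace X]
    [CompactSpace X] [T2Space X] [TotallyDisconnectedSpace X]
    [SecondCountableTopology X] :
    ∃ m : MetricSpace X, m.toUniformSpace.toTopologicalSpace = t ∧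
      ∀ x y z : X, m.dist x z ≤ max (m.dist x y) (m.dist y z) := by
  obtain ⟨f, hf⟩ := exists_isEmbedding_nat_bool X
  let : MetricSpace (ℕ → Bool) := PiNat.metricSpace
  exact ⟨hf.comapMetricSpace f, rfl, fun x y z => PiNat.dist_triangle_nonarch (f x) (f y) (f z)⟩
end

section
/- Let r : α → α → Prop be a transition relation that is image-finite, i.e. for every a the set {b | r a b} is finite. Define the approximants Bis : ℕ → α → α → Prop by: Bis 0 x y always holds; and Bis (n+1) x y holds iff (for every x' with r x x' there exists y' with r y y' and Bis n x' y') and (for every y' with r y y' there exists x' with r x x' and Bis n x' y'). Call a relation R a bisimulation if whenever R x y: for every x' with r x x' there exists y' with r y y' and R x' y', and for every y' with r y y' there exists x' with r x x' and R x' y'. Then two states x, y are bisimilar (i.e. there exists a bisimulation R with R x y) if and only if Bis n x y holds for every n. -/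
/-- The `n`-th bisimulation approximant for a transition relation `r`. -/
def Bis {α : Type*} (r : α → α → Prop) : ℕ → α → α → Prop
  | 0, _, _ => True
  | n + 1, x, y =>
      (∀ x', r x x' → ∃ y', r y y' ∧ Bis r n x' y') ∧
      (∀ y', r y y' → ∃ x', r x x' ∧ Bis r n x' y')

/-- A relation `R` is a bisimulation for `r` when related states have matching
successors, related by `R`. -/
def IsBisimulation {α : Type*} (r : α → α → Prop) (R : α → α → Prop) : Prop :=
  ∀ x y, R x y →
    (∀ x', r x x' → ∃ y', r y y' ∧ R x' y') ∧
    (∀ y', r y y' → ∃ x', r x x' ∧ R x' y')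

/-- A bisimulation is contained in every approximant. -/
theorem IsBisimulation.bis {α : Type*} {r R : α → α → Prop} (hR : IsBisimulation r R) (n : ℕ)
    {x y : α} (h : R x y) : Bis r n x y := by
  induction n generalizing x y with
  | zero => trivial
  | succ n ih =>
    refine ⟨fun x' hx => ?_, fun y' hy => ?_⟩
    · obtain ⟨y', hy, h'⟩ := (hR x y h).1 x' hx
      exact ⟨y', hy, ih h'⟩
    · obtain ⟨x', hx, h'⟩ := (hR x y h).2 y' hy
      exact ⟨x', hx, ih h'⟩

theorem Bis.of_succ {α : Type*} {r : α → α → Prop} {n : ℕ} {x y : α}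
    (h : Bis r (n + 1) x y) : Bis r n x y := by
  induction n generalizing x y with
  | zero => trivial
  | succ n ih =>
    refine ⟨fun x' hx => ?_, fun y' hy => ?_⟩
    · obtain ⟨y', hy, h'⟩ := h.1 x' hx
      exact ⟨y', hy, ih h'⟩
    · obtain ⟨x', hx, h'⟩ := h.2 y' hy
      exact ⟨x', hx, ih h'⟩

theorem antitone_bis {α : Type*} (r : α → α → Prop) : Antitone (Bis r) :=
  antitone_nat_of_succ_le fun _ _ _ => Bis.of_succ

/-- If a decreasing sequence of predicates is satisfiable on a finite set at every stage, then
some element of the set satisfies all of them. -/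
theorem Set.Finite.exists_forall_of_antitone {β : Type*} {s : Set β} (hs : s.Finite)
    {P : ℕ → β → Prop} (hP : Antitone P) (h : ∀ n, ∃ b ∈ s, P n b) :
    ∃ b ∈ s, ∀ n, P n b := by
  by_contra! hne
  choose! f hf using hne
  obtain ⟨N, hN⟩ := (hs.image f).bddAbove
  obtain ⟨b, hb, hPb⟩ := h N
  exact hf b hb (hP (hN (Set.mem_image_of_mem f hb)) b hPb)

/-- For an image-finite relation, the intersection of the approximants is a bisimulation. -/
theorem isBisimulation_forall_bis {α : Type*} {r : α → α → Prop}
    (hfin : ∀ a : α, {b | r a b}.Finite) :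
    IsBisimulation r fun x y => ∀ n, Bis r n x y := by
  refine fun x y h => ⟨fun x' hx => ?_, fun y' hy => ?_⟩
  · exact (hfin y).exists_forall_of_antitone (P := fun n y' => Bis r n x' y')
      (fun _ _ hmn y' => antitone_bis r hmn x' y') fun n => (h (n + 1)).1 _ hx
  · exact (hfin x).exists_forall_of_antitone (P := fun n x' => Bis r n x' y')
      (fun _ _ hmn x' => antitone_bis r hmn x' y') fun n => (h (n + 1)).2 _ hy

/-- For an image-finite transition relation, two states are bisimilar iff all
bisimulation approximants relate them. -/
theorem bisimilar_iff_forall_approx {α : Type*} (r : α → α → Prop)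
    (hfin : ∀ a : α, {b | r a b}.Finite) (x y : α) :
    (∃ R : α → α → Prop, IsBisimulation r R ∧ R x y) ↔ ∀ n, Bis r n x y := by
  exact ⟨fun ⟨_, hR, h⟩ n => hR.bis n h, fun h => ⟨_, isBisimulation_forall_bis hfin, h⟩⟩
end

section
/- Continuous selection in the zero-dimensional case: let X be a compact metric space whose distance satisfies the strong triangle inequality (a compact ultrametric space), let K be a compact subset of X, and let f be a continuous map from K to the space of nonempty compact subsets of X with the Hausdorff metric. Then there exists a continuous map g : K → X such that g(z) ∈ f(z) for every z ∈ K. -/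
open Metric Filter Topology

theorem thickening_subset_of_hausdorffDist_lt {X : Type*} [PseudoMetricSpace X]
    [IsUltrametricDist X] {s t : Set X} {r : ℝ} (hfin : hausdorffEDist s t ≠ ⊤)
    (h : hausdorffDist s t < r) : thickening r s ⊆ thickening r t := by
  intro x hx
  obtain ⟨y, hy, hxy⟩ := mem_thickening_iff.1 hx
  obtain ⟨z, hz, hyz⟩ := exists_dist_lt_of_hausdorffDist_lt hy h hfin
  exact mem_thickening_iff.2 ⟨z, hz, (dist_triangle_max x y z).trans_lt (max_lt hxy hyz)⟩

theorem thickening_eq_of_hausdorffDist_lt {X : Type*} [PseudoMetricSpace X]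
    [IsUltrametricDist X] {s t : Set X} {r : ℝ} (hfin : hausdorffEDist s t ≠ ⊤)
    (h : hausdorffDist s t < r) : thickening r s = thickening r t :=
  (thickening_subset_of_hausdorffDist_lt hfin h).antisymm
    (thickening_subset_of_hausdorffDist_lt (by rwa [hausdorffEDist_comm])
      (by rwa [hausdorffDist_comm]))

/-- Approximate selections: the `n`-th point lies within `1 / 2 / 2 ^ n` of `s`, close to the
preceding point, and is chosen depending only on thickenings of `s`. -/
noncomputable def approxSelection {X : Type*} [PseudoMetricSpace X] [Nonempty X] (s : Set X) :
    ℕ → X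
  | 0 => Classical.epsilon (· ∈ thickening (1 / 2 / 2 ^ 0) s)
  | n + 1 => Classical.epsilon
      (· ∈ thickening (1 / 2 / 2 ^ (n + 1)) s ∩ ball (approxSelection s n) (1 / 2 / 2 ^ n))

section

variable {X : Type*} [PseudoMetricSpace X] [Nonempty X] {s t : Set X}

theorem approxSelection_succ_mem {n : ℕ}
    (h : approxSelection s n ∈ thickening (1 / 2 / 2 ^ n) s) :
    approxSelection s (n + 1) ∈
      thickening (1 / 2 / 2 ^ (n + 1)) s ∩ ball (approxSelection s n) (1 / 2 / 2 ^ n) := by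
  obtain ⟨y, hy, hxy⟩ := mem_thickening_iff.1 h
  rw [approxSelection]
  exact Classical.epsilon_spec
    (p := (· ∈ thickening (1 / 2 / 2 ^ (n + 1)) s ∩ ball (approxSelection s n) (1 / 2 / 2 ^ n)))
    ⟨y, self_subset_thickening (by positivity) s hy, mem_ball'.2 hxy⟩

theorem approxSelection_mem_thickening (hs : s.Nonempty) (n : ℕ) :
    approxSelection s n ∈ thickening (1 / 2 / 2 ^ n) s := by
  induction n with
  | zero =>
    obtain ⟨y, hy⟩ := hs
    rw [approxSelection]
    exact Classical.epsilon_spec (p := (· ∈ thickening (1 / 2 / 2 ^ 0) s))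
      ⟨y, self_subset_thickening (by positivity) s hy⟩
  | succ n ih => exact (approxSelection_succ_mem ih).1

theorem dist_approxSelection_succ_le (hs : s.Nonempty) (n : ℕ) :
    dist (approxSelection s n) (approxSelection s (n + 1)) ≤ 1 / 2 / 2 ^ n :=
  (mem_ball'.1 (approxSelection_succ_mem (approxSelection_mem_thickening hs n)).2).le

theorem approxSelection_eq_of_hausdorffDist_lt [IsUltrametricDist X]
    (hfin : hausdorffEDist s t ≠ ⊤) {n : ℕ} (h : hausdorffDist s t < 1 / 2 / 2 ^ n) :
    approxSelection s n = approxSelection t n := by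
  induction n with
  | zero => rw [approxSelection, approxSelection, thickening_eq_of_hausdorffDist_lt hfin h]
  | succ n ih =>
    have hle : (1 / 2 / 2 ^ (n + 1) : ℝ) ≤ 1 / 2 / 2 ^ n := by
      gcongr
      · norm_num
      · exact n.le_succ
    rw [approxSelection, approxSelection, thickening_eq_of_hausdorffDist_lt hfin h,
      ih (h.trans_le hle)]

end

/-- The hyperspace of nonempty compact subsets of a complete ultrametric space has a continuous
choice function. -/
theorem exists_continuous_choice_nonemptyCompacts (X : Type*) [MetricSpace X]
    [IsUltrametricDist X] [CompleteSpace X] :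
    ∃ σ : TopologicalSpace.NonemptyCompacts X → X,
      Continuous σ ∧ ∀ s : TopologicalSpace.NonemptyCompacts X, σ s ∈ (s : Set X) := by
  rcases isEmpty_or_nonempty X with hX | hX
  · have : IsEmpty (TopologicalSpace.NonemptyCompacts X) := ⟨fun s => hX.false s.nonempty.some⟩
    exact ⟨isEmptyElim, continuous_of_const fun s => isEmptyElim s, fun s => isEmptyElim s⟩
  have hstep (s : TopologicalSpace.NonemptyCompacts X) (n : ℕ) :=
    dist_approxSelection_succ_le s.nonempty n
  choose σ hσ using fun s : TopologicalSpace.NonemptyCompacts X =>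
    cauchySeq_tendsto_of_complete (cauchySeq_of_le_geometric_two (hstep s))
  have hdist (s : TopologicalSpace.NonemptyCompacts X) (n : ℕ) :=
    dist_le_of_le_geometric_two_of_tendsto (hstep s) (hσ s) n
  have hpow : Tendsto (fun n : ℕ => (2 : ℝ) / 2 ^ n) atTop (𝓝 0) :=
    tendsto_const_nhds.div_atTop (tendsto_pow_atTop_atTop_of_one_lt one_lt_two)
  refine ⟨σ, Metric.continuous_iff.2 fun s ε hε => ?_, fun s => ?_⟩
  · obtain ⟨n, hn⟩ := (hpow.eventually (gt_mem_nhds hε)).exists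
    refine ⟨1 / 2 / 2 ^ n, by positivity, fun t hts => ?_⟩
    rw [NonemptyCompacts.dist_eq] at hts
    have heq := approxSelection_eq_of_hausdorffDist_lt
      (hausdorffEDist_ne_top_of_nonempty_of_bounded t.nonempty s.nonempty
        t.isCompact.isBounded s.isCompact.isBounded) hts
    have ht := hdist t n
    rw [heq] at ht
    calc dist (σ t) (σ s) ≤ 1 / 2 ^ n + 1 / 2 ^ n :=
          (dist_triangle_left _ _ _).trans (add_le_add ht (hdist s n))
      _ = 2 / 2 ^ n := by ring
      _ < ε := hn
  · refine s.isCompact.isClosed.closure_subset (Metric.mem_closure_iff.2 fun ε hε => ?_)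
    obtain ⟨n, hn⟩ := (hpow.eventually (gt_mem_nhds hε)).exists
    obtain ⟨y, hy, hxy⟩ := mem_thickening_iff.1 (approxSelection_mem_thickening s.nonempty n)
    refine ⟨y, hy, ?_⟩
    calc dist (σ s) y ≤ 1 / 2 ^ n + 1 / 2 / 2 ^ n :=
          (dist_triangle_left _ _ _).trans (add_le_add (hdist s n) hxy.le)
      _ ≤ 2 / 2 ^ n := by
          rw [← add_div]
          gcongr
          norm_num
      _ < ε := hn

/-- Continuous selection in the zero-dimensional case: a continuous map from a
compact subset of a compact ultrametric space to the hyperspace of nonempty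
compact subsets admits a continuous selection. -/
theorem continuous_selection_ultrametric (X : Type*) [MetricSpace X]
    [IsUltrametricDist X] [CompactSpace X] (K : Set X) (hK : IsCompact K)
    (f : K → TopologicalSpace.NonemptyCompacts X) (hf : Continuous f) :
    ∃ g : K → X, Continuous g ∧ ∀ z : K, g z ∈ (f z : Set X) := by
  obtain ⟨σ, hσ, hmem⟩ := exists_continuous_choice_nonemptyCompacts X
  exact ⟨σ ∘ f, hσ.comp hf, fun z => hmem (f z)⟩
end

section
/- The Vietoris construction preserves second-countable Stone spaces: if X is a compact, Hausdorff, totally disconnected, second-countable topological space, then the set of nonempty compact subsets of X equipped with the Vietoris topology is also compact, Hausdorff, totally disconnected, and second-countable. -/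
/-- The Vietoris topology on the nonempty compact subsets of a topological space:
generated by the sets `□U = {C | C ⊆ U}` and `◇U = {C | C ∩ U ≠ ∅}` for `U` open. -/
def vietorisTopology (X : Type*) [TopologicalSpace X] :
    TopologicalSpace (TopologicalSpace.NonemptyCompacts X) :=
  TopologicalSpace.generateFrom
    ({S | ∃ U : Set X, IsOpen U ∧
        S = {C : TopologicalSpace.NonemptyCompacts X | (C : Set X) ⊆ U}} ∪
     {S | ∃ U : Set X, IsOpen U ∧
        S = {C : TopologicalSpace.NonemptyCompacts X | ((C : Set X) ∩ U).Nonempty}})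

theorem vietorisTopology_eq (X : Type*) [TopologicalSpace X] :
    vietorisTopology X = TopologicalSpace.NonemptyCompacts.topology := by
  rw [vietorisTopology, TopologicalSpace.NonemptyCompacts.topology, TopologicalSpace.vietoris,
    induced_generateFrom_eq, Set.image_union, Set.image_image, Set.image_image]
  congr 2 <;> ext S <;>
    exact exists_congr fun U => and_congr_right fun _ => eq_comm

/-- If distinct points are separated by clopen sets, so are distinct nonempty compact sets. -/
theorem TopologicalSpace.NonemptyCompacts.totallySeparatedSpace (X : Type*) [TopologicalSpace X]
    [CompactSpace X] [T2Space X] [TotallyDisconnectedSpace X] :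
    TotallySeparatedSpace (NonemptyCompacts X) := by
  have separate (C D : NonemptyCompacts X) (h : ¬ (C : Set X) ⊆ D) :
      ∃ W : Set (NonemptyCompacts X), IsClopen W ∧ C ∈ W ∧ D ∈ Wᶜ := by
    obtain ⟨x, hxC, hxD⟩ := Set.not_subset.mp h
    obtain ⟨V, hV, hxV, hVD⟩ :=
      compact_exists_isClopen_in_isOpen D.isCompact.isClosed.isOpen_compl hxD
    exact ⟨{K | ((K : Set X) ∩ V).Nonempty},
      ⟨isClosed_inter_nonempty_of_isClosed hV.isClosed,
        isOpen_inter_nonempty_of_isOpen hV.isOpen⟩,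
      ⟨x, hxC, hxV⟩, fun ⟨y, hyD, hyV⟩ => hVD hyV hyD⟩
  refine totallySeparatedSpace_iff_exists_isClopen.mpr fun C D hCD => ?_
  by_cases h : (C : Set X) ⊆ D
  · obtain ⟨W, hW, hD, hC⟩ := separate D C fun h' => hCD (SetLike.coe_injective (h.antisymm h'))
    exact ⟨Wᶜ, hW.compl, hC, by simpa using hD⟩
  · exact separate C D h

/-- The Vietoris construction preserves second-countable Stone spaces. -/
theorem vietoris_preserves_second_countable_stone (X : Type*) [TopologicalSpace X]
    [CompactSpace X] [T2Space X] [TotallyDisconnectedSpace X]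
    [SecondCountableTopology X] :
    @CompactSpace _ (vietorisTopology X) ∧
    @T2Space _ (vietorisTopology X) ∧
    @TotallyDisconnectedSpace _ (vietorisTopology X) ∧
    @SecondCountableTopology _ (vietorisTopology X) := by
  rw [vietorisTopology_eq]
  have := TopologicalSpace.NonemptyCompacts.totallySeparatedSpace X
  exact ⟨inferInstance, inferInstance, inferInstance, inferInstance⟩
end
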